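/- For every connected graph G on n vertices with an interval representation of width k, there exists a partition of V into at most f(k) lanes, each lane being a sequence of vertices whose intervals are pairwise disjoint and strictly increasing, such that the 'weak completion' edges (connecting consecutive vertices within each lane) can be embedded as paths in G with every edge of G used by at most g(k) of these paths; here f(1)=1, f(k)=2+2(k−1)f(k−1), g(1)=0, g(k)=2+g(k−1)+2k·f(k−1). -/

import Mathlib

/-- `flane 1 = 1`, `flane k = 2 + 2(k-1)·flane (k-1)` for `k > 1`. -/
def flane : ℕ → ℕ
  | 0 => 0
  | 1 => 1
  | (k + 2) => 2 + 2 * (k + 1) * flane (k + 1)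

/-- `glane 1 = 0`, `glane k = 2 + glane (k-1) + 2k·flane (k-1)` for `k > 1`. -/
def glane : ℕ → ℕ
  | 0 => 0
  | 1 => 0
  | (k + 2) => 2 + glane (k + 1) + 2 * (k + 2) * flane (k + 1)


/-- The restriction of `G` to a vertex set, still as a graph on `V`. -/
def restr {V : Type*} (G : SimpleGraph V) (A : Set V) : SimpleGraph V where
  Adj x y := G.Adj x y ∧ x ∈ A ∧ y ∈ A
  symm := ⟨fun _ _ h => ⟨h.1.symm, h.2.2, h.2.1⟩⟩
  loopless := ⟨fun _ h => h.1.ne rfl⟩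

/-- `u`, `v` are consecutive in a colour class of `c` inside `A`. -/
def Cons {V : Type*} (L R : V → ℤ) (A : Set V) (c : V → ℕ) (u v : V) : Prop :=
  u ∈ A ∧ v ∈ A ∧ c u = c v ∧ R u < L v ∧
    ∀ w ∈ A, c w = c u → ¬ (R u < L w ∧ R w < L v)

/-- The inductive statement. -/
def Key {V : Type*} (G : SimpleGraph V) (L R : V → ℤ) (k : ℕ) : Prop :=
  ∀ A : Set V, (∀ u ∈ A, ∀ v ∈ A, (restr G A).Reachable u v) →
    (∀ x : ℤ, {v | v ∈ A ∧ L v ≤ x ∧ x ≤ R v}.ncard ≤ k) →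
    ∃ (c : V → ℕ) (E : V → V → SimpleGraph V),
      (∀ v ∈ A, c v < flane k) ∧
      (∀ u ∈ A, ∀ v ∈ A, u ≠ v → c u = c v → R u < L v ∨ R v < L u) ∧
      (∀ u v, Cons L R A c u v → E u v ≤ restr G A ∧ (E u v).Reachable u v) ∧
      ∀ e, {q : V × V | Cons L R A c q.1 q.2 ∧ e ∈ (E q.1 q.2).edgeSet}.ncard ≤ glane k

/-- Leaving a set along a reachability witness. -/
lemma exists_exit {V : Type*} (H : SimpleGraph V) (B : Set V) {x y : V}
    (h : H.Reachable x y) (hx : x ∈ B) (hy : y ∉ B) :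
    ∃ u ∈ B, ∃ v, v ∉ B ∧ H.Adj u v := by
  obtain ⟨p⟩ := h
  induction p with
  | nil => exact absurd hx hy
  | @cons a b c hab p ih =>
    by_cases hb : b ∈ B
    · exact ih hb hy
    · exact ⟨a, hx, b, hb, hab⟩

/-- Components of a restriction are connected inside themselves. -/
lemma comp_conn {V : Type*} (G : SimpleGraph V) (D : Set V) {u v : V}
    (h : (restr G D).Reachable u v) (hu : u ∈ D) :
    (restr G {y | y ∈ D ∧ (restr G D).connectedComponentMk y =
      (restr G D).connectedComponentMk u}).Reachable u v := by
  obtain ⟨p⟩ := h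
  induction p with
  | nil => exact SimpleGraph.Reachable.refl _
  | @cons a b c hab p ih =>
    have hb : b ∈ D := hab.2.2
    have hK : (restr G D).connectedComponentMk b = (restr G D).connectedComponentMk a :=
      SimpleGraph.ConnectedComponent.eq.2 hab.symm.reachable
    have h2 := ih hb
    rw [hK] at h2
    refine SimpleGraph.Reachable.trans (SimpleGraph.Adj.reachable ?_) h2
    exact ⟨hab.1, ⟨hu, rfl⟩, ⟨hb, hK⟩⟩

/-- Connected sets of vertices cover their hull. -/
lemma hull_cover {V : Type*} (G : SimpleGraph V) (L R : V → ℤ)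
    (hadj : ∀ u v : V, G.Adj u v → L u ≤ R v)
    (B : Set V) {u v : V} (h : (restr G B).Reachable u v) (hu : u ∈ B) {x : ℤ}
    (hux : L u ≤ x) (hvx : x ≤ R v) : ∃ w ∈ B, L w ≤ x ∧ x ≤ R w := by
  by_contra hcon
  push Not at hcon
  have hv : v ∈ {w | w ∈ B ∧ R w < x} := by
    by_contra hv
    obtain ⟨y, hy, z, hz, hyz⟩ := exists_exit _ _ h (show u ∈ {w | w ∈ B ∧ R w < x} from
      ⟨hu, hcon u hu hux⟩) hv
    apply hz
    refine ⟨hyz.2.2, hcon z hyz.2.2 ?_⟩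
    have := hadj z y hyz.1.symm
    have := hy.2
    omega
  have := hv.2
  omega

/-- Interval colouring. -/
lemma interval_coloring {ι : Type*} (w : ℕ) (lo hi : ι → ℤ) (F : Finset ι)
    (hle : ∀ i ∈ F, lo i ≤ hi i)
    (hw : ∀ x : ℤ, {i | i ∈ F ∧ lo i ≤ x ∧ x ≤ hi i}.ncard ≤ w) :
    ∃ d : ι → ℕ, (∀ i ∈ F, d i < w) ∧
      ∀ i ∈ F, ∀ j ∈ F, i ≠ j → d i = d j → hi i < lo j ∨ hi j < lo i := by
  classical
  induction F using Finset.induction_on_max_value lo with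
  | empty => exact ⟨fun _ => 0, by simp, by simp⟩
  | insert a s ha hmax ih =>
    obtain ⟨d, hd1, hd2⟩ := ih (fun i hi => hle i (Finset.mem_insert_of_mem hi)) (by
      intro x
      refine le_trans (Set.ncard_le_ncard ?_ ?_) (hw x)
      · rintro i ⟨h1, h2⟩
        exact ⟨Finset.mem_insert_of_mem h1, h2⟩
      · exact (insert a s).finite_toSet.subset (fun i h => h.1))
    set T := s.filter (fun i => lo a ≤ hi i) with hT
    have hcard : T.card < w := by
      have h1 := hw (lo a)
      have h2 : {i | i ∈ insert a s ∧ lo i ≤ lo a ∧ lo a ≤ hi i} = ↑(insert a T) := by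
        ext i
        simp only [Set.mem_ofPred_eq, Finset.mem_insert, Finset.coe_insert, Set.mem_insert_iff,
          Finset.mem_coe, hT, Finset.mem_filter]
        constructor
        · rintro ⟨h | h, h'⟩
          · exact Or.inl h
          · exact Or.inr ⟨h, h'.2⟩
        · rintro (h | h)
          · subst h
            exact ⟨Or.inl rfl, le_refl _, hle _ (Finset.mem_insert_self _ _)⟩
          · exact ⟨Or.inr h.1, hmax i h.1, h.2⟩
      rw [h2, Set.ncard_coe_finset, Finset.card_insert_of_notMem (by simp [hT, ha])] at h1
      omega
    obtain ⟨col, hcol, hcol'⟩ : ∃ col ∈ Finset.range w, col ∉ T.image d := by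
      apply Finset.exists_mem_notMem_of_card_lt_card
      rw [Finset.card_range]
      exact lt_of_le_of_lt Finset.card_image_le hcard
    have hfar : ∀ j ∈ s, col = d j → hi j < lo a := by
      intro j hj h
      by_contra hc
      apply hcol'
      rw [h]
      exact Finset.mem_image_of_mem d (by simp [hT, hj]; omega)
    refine ⟨fun i => if i = a then col else d i, ?_, ?_⟩
    · intro i hi
      by_cases h : i = a
      · simpa [h] using hcol
      · simpa [h] using hd1 i (by simpa [h] using hi)
    · intro i hi j hj hij hc
      by_cases h : i = a
      · have hja : j ≠ a := fun h' => hij (h.trans h'.symm)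
        simp only [h, hja, if_true, if_false] at hc
        right
        rw [h]
        exact hfar j (by simpa [hja] using hj) hc
      · by_cases hja : j = a
        · simp only [h, hja, if_true, if_false] at hc
          left
          rw [hja]
          exact hfar i (by simpa [h] using hi) hc.symm
        · simp only [h, hja, if_false] at hc
          exact hd2 i (by simpa [h] using hi) j (by simpa [hja] using hj) hij hc

/-- Greedy choice of a covering subsequence of a sequence of intervals. -/
lemma greedy (N : ℕ) (l r : ℕ → ℤ) (hlr : ∀ i, l i ≤ r i)
    (h1 : ∀ i < N, l (i + 1) ≤ r i) :
    ∃ (M : ℕ) (t : ℕ → ℕ), t 0 = 0 ∧ t M = N ∧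
      (∀ i j, i < j → j ≤ M → t i < t j) ∧
      (∀ i < M, l (t (i + 1)) ≤ r (t i)) ∧
      (∀ i j, i + 2 ≤ j → j ≤ M → r (t i) < l (t j)) := by
  classical
  let nx : ℕ → ℕ := fun i => Nat.findGreatest (fun j => l j ≤ r i) N
  have nx_le : ∀ i, nx i ≤ N := fun i => Nat.findGreatest_le _
  have nx_gt : ∀ i < N, i < nx i := fun i hi =>
    Nat.le_findGreatest (P := fun j => l j ≤ r i) hi (h1 i hi)
  have nx_spec : ∀ i ≤ N, l (nx i) ≤ r i := fun i hi =>
    Nat.findGreatest_spec (P := fun j => l j ≤ r i) hi (hlr i)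
  have nx_far : ∀ i j, nx i < j → j ≤ N → r i < l j := fun i j hj hN => by
    have := Nat.findGreatest_is_greatest (P := fun j => l j ≤ r i) hj hN
    omega
  let t : ℕ → ℕ := fun n => nx^[n] 0
  have ht : ∀ n, t (n + 1) = nx (t n) := fun n => Function.iterate_succ_apply' nx n 0
  have hex : ∃ n, N ≤ t n := by
    have : ∀ n, n ≤ t n ∨ N ≤ t n := by
      intro n
      induction n with
      | zero => left; exact Nat.zero_le _
      | succ n ih =>
        by_cases hN : N ≤ t n
        · right
          have h3 : N ≤ nx (t n) := by
            by_cases hz : t n ≤ N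
            · have : t n = N := by omega
              rw [this]
              exact Nat.le_findGreatest (P := fun j => l j ≤ r N) le_rfl (hlr N)
            · exfalso
              cases n with
              | zero => exact hz (Nat.zero_le _)
              | succ n => exact hz (by rw [ht]; exact nx_le _)
          rw [ht]; exact h3
        · left
          rw [ht]
          have := nx_gt (t n) (by omega)
          omega
    refine ⟨N, ?_⟩
    rcases this N with h | h <;> exact h
  have hle : ∀ n, t n ≤ N := by
    intro n
    cases n with
    | zero => exact Nat.zero_le _
    | succ n => rw [ht]; exact nx_le _
  have hlt : ∀ i < Nat.find hex, t i < N := fun i hi => by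
    have := Nat.find_min hex hi
    omega
  have hmono : ∀ i j, i < j → j ≤ Nat.find hex → t i < t j := by
    intro i j hij
    induction j with
    | zero => omega
    | succ j ih =>
      intro hj
      have h3 : t j < t (j + 1) := by
        rw [ht]; exact nx_gt _ (hlt j (by omega))
      rcases Nat.lt_succ_iff_lt_or_eq.1 hij with h | h
      · exact lt_trans (ih h (by omega)) h3
      · rw [h]; exact h3
  refine ⟨Nat.find hex, t, rfl, le_antisymm (hle _) (Nat.find_spec hex), hmono, ?_, ?_⟩
  · intro i hi
    rw [ht]; exact nx_spec _ (hle _)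
  · intro i j hij hj
    apply nx_far _ _ _ (hle _)
    rw [← ht]
    exact hmono _ _ (by omega) hj

/-- Sorting a finite family of pairwise disjoint intervals. -/
lemma sort_lane {V : Type*} (L R : V → ℤ) (hLR : ∀ v, L v ≤ R v) (F : Finset V)
    (hne : F.Nonempty)
    (hd : ∀ u ∈ F, ∀ v ∈ F, u ≠ v → R u < L v ∨ R v < L u) :
    ∃ (m : ℕ) (P : ℕ → V), (∀ v, v ∈ F ↔ ∃ j ≤ m, P j = v) ∧
      ∀ i j, i < j → j ≤ m → R (P i) < L (P j) := by
  classical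
  induction F using Finset.induction_on_max_value L with
  | empty => exact absurd hne (by simp)
  | insert a s ha hmax ih =>
    rcases s.eq_empty_or_nonempty with rfl | hs
    · refine ⟨0, fun _ => a, ?_, ?_⟩
      · intro v
        constructor
        · intro h; exact ⟨0, le_rfl, by simpa using (by simpa using h : v = a).symm⟩
        · rintro ⟨_, _, h⟩; simp [h.symm]
      · intro i j h1 h2; omega
    · obtain ⟨m, P, hP1, hP2⟩ := ih hs (fun u hu v hv => hd u (Finset.mem_insert_of_mem hu) v
        (Finset.mem_insert_of_mem hv))
      refine ⟨m + 1, fun j => if j ≤ m then P j else a, ?_, ?_⟩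
      · intro v
        rw [Finset.mem_insert, hP1]
        constructor
        · rintro (h | ⟨j, hj, h⟩)
          · exact ⟨m + 1, le_rfl, by simp [h]⟩
          · exact ⟨j, by omega, by simp [hj, h]⟩
        · rintro ⟨j, hj, h⟩
          by_cases hjm : j ≤ m
          · right; exact ⟨j, hjm, by simpa [hjm] using h⟩
          · left; simpa [hjm] using h.symm
      · intro i j hij hj
        have him : i ≤ m := by omega
        by_cases hjm : j ≤ m
        · simpa [him, hjm] using hP2 i j hij hjm
        · simp only [him, hjm, if_true, if_false]
          have hi : P i ∈ s := (hP1 _).2 ⟨i, him, rfl⟩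
          have hne : P i ≠ a := fun h => ha (h ▸ hi)
          rcases hd _ (Finset.mem_insert_of_mem hi) a (Finset.mem_insert_self _ _) hne with h | h
          · exact h
          · have := hmax _ hi
            have := hLR a
            have := hLR (P i)
            omega

lemma spine {V : Type*} [Finite V] (G : SimpleGraph V) (L R : V → ℤ) (hLR : ∀ v, L v ≤ R v)
    (hadj : ∀ u v : V, G.Adj u v → L u ≤ R v) (A : Set V) (hne : A.Nonempty)
    (hA : ∀ u ∈ A, ∀ v ∈ A, (restr G A).Reachable u v) :
    ∃ (N M : ℕ) (P : ℕ → V) (t : ℕ → ℕ),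
      (∀ i ≤ N, P i ∈ A) ∧ (∀ i < N, (restr G A).Adj (P i) (P (i + 1))) ∧
      (∀ i ≤ N, ∀ j ≤ N, P i = P j → i = j) ∧
      (∀ i ≤ M, t i ≤ N) ∧ (∀ i j, i < j → j ≤ M → t i < t j) ∧
      (∀ i j, i + 2 ≤ j → j ≤ M → R (P (t i)) < L (P (t j))) ∧
      (∀ v ∈ A, ∀ x, L v ≤ x → x ≤ R v →
        ∃ n ≤ M, L (P (t n)) ≤ x ∧ x ≤ R (P (t n))) := by
  classical
  obtain ⟨a, ha, hamin⟩ := Set.exists_min_image A L A.toFinite hne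
  obtain ⟨b, hb, hbmax⟩ := Set.exists_max_image A R A.toFinite hne
  obtain ⟨p, hp⟩ := (hA a ha b hb).exists_isPath
  have hPadj : ∀ i < p.length, (restr G A).Adj (p.getVert i) (p.getVert (i + 1)) :=
    fun i hi => p.adj_getVert_succ hi
  obtain ⟨M, t, ht0, htM, hmono, hcl, hfar⟩ := greedy p.length (fun i => L (p.getVert i))
    (fun i => R (p.getVert i)) (fun i => hLR _)
    (fun i hi => hadj _ _ (hPadj i hi).1.symm)
  refine ⟨p.length, M, p.getVert, t, ?_, hPadj, ?_, ?_, hmono, hfar, ?_⟩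
  · intro i hi
    rcases Nat.lt_or_ge i p.length with h | h
    · exact (hPadj i h).2.1
    · rw [p.getVert_of_length_le h]; exact hb
  · intro i hi j hj h
    exact hp.getVert_injOn hi hj h
  · intro i hi
    rcases Nat.lt_or_ge i M with h | h
    · exact htM ▸ (hmono i M h le_rfl).le
    · have : i = M := by omega
      rw [this, htM]
  · intro v hv x hx1 hx2
    have hex : ∃ n, n ≤ M ∧ x ≤ R (p.getVert (t n)) := by
      refine ⟨M, le_rfl, ?_⟩
      rw [htM, p.getVert_length]
      exact hx2.trans (hbmax v hv)
    refine ⟨Nat.find hex, (Nat.find_spec hex).1, ?_, (Nat.find_spec hex).2⟩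
    rcases hn : Nat.find hex with _ | n
    · rw [ht0, p.getVert_zero]
      exact (hamin v hv).trans hx1
    · have h1 := Nat.find_min hex (m := n) (by omega)
      have h2 := (Nat.find_spec hex).1
      have h3 := hcl n (by omega)
      by_contra h4
      exact h1 ⟨by omega, by omega⟩

/-- Colouring of the components. -/
lemma comp_coloring {V κT : Type*} [Finite V] [Nonempty V] [Finite κT] (G : SimpleGraph V) (L R : V → ℤ)
    (hLR : ∀ v, L v ≤ R v)
    (hadj : ∀ u v : V, G.Adj u v → L u ≤ R v) (D : Set V) (κ : V → κT) (w : ℕ)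
    (hconn : ∀ K, ∀ u ∈ {y | y ∈ D ∧ κ y = K}, ∀ v ∈ {y | y ∈ D ∧ κ y = K},
      (restr G {y | y ∈ D ∧ κ y = K}).Reachable u v)
    (hw : ∀ x : ℤ, {v | v ∈ D ∧ L v ≤ x ∧ x ≤ R v}.ncard ≤ w) :
    ∃ d : κT → ℕ, (∀ v ∈ D, d (κ v) < w) ∧
      (∀ u ∈ D, ∀ v ∈ D, κ u ≠ κ v → d (κ u) = d (κ v) → R u < L v ∨ R v < L u) ∧
      ∀ u ∈ D, ∀ v ∈ D, κ u ≠ κ v → d (κ u) = d (κ v) → R u < L v →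
        ∀ x ∈ D, ∀ y ∈ D, κ x = κ u → κ y = κ v → R x < L y := by
  classical
  have h1 : ∀ K, ∃ a b, K ∈ κ '' D → (a ∈ D ∧ κ a = K ∧ b ∈ D ∧ κ b = K ∧
      ∀ v ∈ D, κ v = K → L a ≤ L v ∧ R v ≤ R b) := by
    intro K
    by_cases hK : K ∈ κ '' D
    · have hne : {y | y ∈ D ∧ κ y = K}.Nonempty := hK
      obtain ⟨a, ha, hamin⟩ := Set.exists_min_image _ L (Set.toFinite _) hne
      obtain ⟨b, hb, hbmax⟩ := Set.exists_max_image _ R (Set.toFinite _) hne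
      exact ⟨a, b, fun _ => ⟨ha.1, ha.2, hb.1, hb.2, fun v h1 h2 =>
        ⟨hamin v ⟨h1, h2⟩, hbmax v ⟨h1, h2⟩⟩⟩⟩
    · exact ⟨Classical.arbitrary V, Classical.arbitrary V, fun h => absurd h hK⟩
  choose a b hab using h1
  have hfin : (κ '' D).Finite := Set.toFinite _
  obtain ⟨d, hd1, hd2⟩ := interval_coloring w (fun K => L (a K)) (fun K => R (b K)) hfin.toFinset
    (by
      intro K hK
      have h := hab K (by simpa using hK)
      exact (hLR _).trans (h.2.2.2.2 _ h.1 h.2.1).2)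
    (by
      intro x
      refine le_trans ?_ (hw x)
      have hpt : ∀ K, ∃ v, (K ∈ κ '' D ∧ L (a K) ≤ x ∧ x ≤ R (b K)) →
          (v ∈ D ∧ L v ≤ x ∧ x ≤ R v) ∧ κ v = K := by
        intro K
        by_cases hK : (K ∈ κ '' D ∧ L (a K) ≤ x ∧ x ≤ R (b K))
        · have h := hab K hK.1
          obtain ⟨v, hv, hvx⟩ := hull_cover G L R hadj {y | y ∈ D ∧ κ y = K}
            (hconn K (a K) ⟨h.1, h.2.1⟩ (b K) ⟨h.2.2.1, h.2.2.2.1⟩) ⟨h.1, h.2.1⟩ hK.2.1 hK.2.2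
          exact ⟨v, fun _ => ⟨⟨hv.1, hvx⟩, hv.2⟩⟩
        · exact ⟨a K, fun h => absurd h hK⟩
      choose g hg using hpt
      refine Set.ncard_le_ncard_of_injOn g ?_ ?_ (Set.toFinite _)
      · rintro K ⟨h1, h2⟩
        exact (hg K ⟨by simpa using h1, h2⟩).1
      · rintro K ⟨h1, h2⟩ K' ⟨h1', h2'⟩ h
        rw [← (hg K ⟨by simpa using h1, h2⟩).2, ← (hg K' ⟨by simpa using h1', h2'⟩).2, h])
  refine ⟨d, ?_, ?_, ?_⟩
  · intro v hv
    exact hd1 _ (by simpa using ⟨v, hv, rfl⟩)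
  · intro u hu v hv hne hd
    have h3 := ((hab (κ u) ⟨u, hu, rfl⟩).2.2.2.2 u hu rfl)
    have h4 := ((hab (κ v) ⟨v, hv, rfl⟩).2.2.2.2 v hv rfl)
    rcases hd2 (κ u) (by simpa using ⟨u, hu, rfl⟩) (κ v) (by simpa using ⟨v, hv, rfl⟩) hne hd
      with h | h
    · left; omega
    · right; omega
  · intro u hu v hv hne hd huv x hx y hy hxu hyv
    have hKu := hab (κ u) ⟨u, hu, rfl⟩
    have hKv := hab (κ v) ⟨v, hv, rfl⟩
    have h1 := (hKu.2.2.2.2 x hx hxu).2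
    have h2 := (hKv.2.2.2.2 y hy hyv).1
    have h3 := (hKu.2.2.2.2 u hu rfl)
    have h4 := (hKv.2.2.2.2 v hv rfl)
    have h5 := hLR u
    have h6 := hLR v
    rcases hd2 (κ u) (by simpa using ⟨u, hu, rfl⟩) (κ v) (by simpa using ⟨v, hv, rfl⟩) hne hd
      with h | h
    · omega
    · omega

lemma Cons.succ_unique {V : Type*} {L R : V → ℤ} {A : Set V} {c : V → ℕ}
    (hd : ∀ u ∈ A, ∀ v ∈ A, u ≠ v → c u = c v → R u < L v ∨ R v < L u)
    {u v v' : V} (h : Cons L R A c u v) (h' : Cons L R A c u v') : v = v' := by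
  by_contra hne
  rcases hd v h.2.1 v' h'.2.1 hne (h.2.2.1.symm.trans h'.2.2.1) with h1 | h1
  · exact h'.2.2.2.2 v h.2.1 h.2.2.1.symm ⟨h.2.2.2.1, h1⟩
  · exact h.2.2.2.2 v' h'.2.1 h'.2.2.1.symm ⟨h'.2.2.2.1, h1⟩

lemma Cons.pred_unique {V : Type*} {L R : V → ℤ} {A : Set V} {c : V → ℕ}
    (hd : ∀ u ∈ A, ∀ v ∈ A, u ≠ v → c u = c v → R u < L v ∨ R v < L u)
    {u u' v : V} (h : Cons L R A c u v) (h' : Cons L R A c u' v) : u = u' := by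
  by_contra hne
  rcases hd u h.1 u' h'.1 hne (h.2.2.1.trans h'.2.2.1.symm) with h1 | h1
  · exact h.2.2.2.2 u' h'.1 (h'.2.2.1.trans h.2.2.1.symm) ⟨h1, h'.2.2.2.1⟩
  · exact h'.2.2.2.2 u h.1 (h.2.2.1.trans h'.2.2.1.symm) ⟨h1, h.2.2.2.1⟩

/-- The part of a path between positions `i` and `j`. -/
def seg {V : Type*} (P : ℕ → V) (i j : ℕ) : SimpleGraph V :=
  SimpleGraph.fromEdgeSet {e | ∃ l, i ≤ l ∧ l < j ∧ e = s(P l, P (l + 1))}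

lemma seg_le {V : Type*} (H : SimpleGraph V) (P : ℕ → V) (N i j : ℕ) (hj : j ≤ N)
    (hP : ∀ i < N, H.Adj (P i) (P (i + 1))) : seg P i j ≤ H := by
  intro x y h
  obtain ⟨⟨l, h1, h2, h3⟩, _⟩ := (SimpleGraph.fromEdgeSet_adj _).1 h
  rw [← SimpleGraph.mem_edgeSet, h3]
  exact hP l (by omega)

lemma seg_mem {V : Type*} (P : ℕ → V) (i j : ℕ) (e : Sym2 V) (h : e ∈ (seg P i j).edgeSet) :
    ∃ l, i ≤ l ∧ l < j ∧ e = s(P l, P (l + 1)) := by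
  rw [seg, SimpleGraph.edgeSet_fromEdgeSet] at h
  exact h.1

lemma seg_reach {V : Type*} (H : SimpleGraph V) (P : ℕ → V) (N i j : ℕ) (hij : i ≤ j)
    (hj : j ≤ N) (hP : ∀ i < N, H.Adj (P i) (P (i + 1))) :
    (seg P i j).Reachable (P i) (P j) := by
  induction j, hij using Nat.le_induction with
  | base => exact SimpleGraph.Reachable.refl _
  | succ j hij ih =>
    refine SimpleGraph.Reachable.trans ((ih (by omega)).mono ?_) (SimpleGraph.Adj.reachable ?_)
    · apply SimpleGraph.fromEdgeSet_mono
      rintro e ⟨l, h1, h2, h3⟩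
      exact ⟨l, h1, by omega, h3⟩
    · exact (SimpleGraph.fromEdgeSet_adj _).2 ⟨⟨j, hij, by omega, rfl⟩, (hP j (by omega)).ne⟩

/-- Congestion of monotone routes along a path: at most one per colour. -/
lemma count_spine {V : Type*} [Finite V] {L R : V → ℤ} {A : Set V} {c φ : V → ℕ}
    (hd : ∀ u ∈ A, ∀ v ∈ A, u ≠ v → c u = c v → R u < L v ∨ R v < L u)
    (F N : ℕ) (hc : ∀ v ∈ A, c v < F) (P : ℕ → V)
    (hinj : ∀ i ≤ N, ∀ j ≤ N, P i = P j → i = j) (hφN : ∀ v ∈ A, φ v ≤ N)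
    (hφ : ∀ u ∈ A, ∀ v ∈ A, c u = c v → R u < L v → φ u ≤ φ v) (e : Sym2 V) :
    {q : V × V | Cons L R A c q.1 q.2 ∧ e ∈ (seg P (φ q.1) (φ q.2)).edgeSet}.ncard ≤ F := by
  classical
  have key : ∀ u v u' v' : V, Cons L R A c u v → Cons L R A c u' v' → c u = c u' →
      e ∈ (seg P (φ u) (φ v)).edgeSet → e ∈ (seg P (φ u') (φ v')).edgeSet →
      ¬ R u < L u' := by
    intro u v u' v' h h' hcc he he' hlt
    obtain ⟨l, h1, h2, h3⟩ := seg_mem _ _ _ _ he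
    obtain ⟨l', h1', h2', h3'⟩ := seg_mem _ _ _ _ he'
    have hv := hφN v h.2.1
    have hv' := hφN v' h'.2.1
    have hll : l = l' := by
      rw [h3, Sym2.eq_iff] at h3'
      rcases h3' with ⟨h4, h5⟩ | ⟨h4, h5⟩
      · exact hinj _ (by omega) _ (by omega) h4
      · have h6 := hinj _ (by omega) _ (by omega) h4
        have h7 := hinj _ (by omega) _ (by omega) h5
        omega
    have hvu : φ v ≤ φ u' := by
      by_cases heq : v = u'
      · rw [heq]
      · rcases hd v h.2.1 u' h'.1 heq (h.2.2.1.symm.trans hcc) with h4 | h4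
        · exact hφ v h.2.1 u' h'.1 (h.2.2.1.symm.trans hcc) h4
        · exact absurd ⟨hlt, h4⟩ (h.2.2.2.2 u' h'.1 hcc.symm)
    omega
  have := Set.ncard_le_ncard_of_injOn (s := {q : V × V | Cons L R A c q.1 q.2 ∧
      e ∈ (seg P (φ q.1) (φ q.2)).edgeSet}) (t := (Finset.range F : Set ℕ)) (fun q => c q.1)
    (by
      rintro ⟨u, v⟩ ⟨h, -⟩
      simpa using hc u h.1)
    (by
      rintro ⟨u, v⟩ ⟨h, he⟩ ⟨u', v'⟩ ⟨h', he'⟩ hcc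
      have huu : u = u' := by
        by_contra hne
        rcases hd u h.1 u' h'.1 hne hcc with h1 | h1
        · exact key u v u' v' h h' hcc he he' h1
        · exact key u' v' u v h' h hcc.symm he' he h1
      subst huu
      exact Prod.ext rfl (h.succ_unique hd h'))
    (Set.toFinite _)
  simpa using this

lemma key_zero {V : Type*} [Finite V] (G : SimpleGraph V) (L R : V → ℤ)
    (hLR : ∀ v, L v ≤ R v) : Key G L R 0 := by
  intro A _ hw
  have hA : ∀ v, v ∉ A := by
    intro v hv
    have h := hw (L v)
    rw [Nat.le_zero, Set.ncard_eq_zero (Set.toFinite _)] at h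
    exact Set.eq_empty_iff_forall_notMem.1 h v ⟨hv, le_rfl, hLR v⟩
  refine ⟨fun _ => 0, fun _ _ => ⊥, fun v hv => absurd hv (hA v), fun v hv => absurd hv (hA v),
    fun u v h => absurd h.1 (hA u), fun e => ?_⟩
  simp

lemma key_one {V : Type*} [Finite V] (G : SimpleGraph V) (L R : V → ℤ)
    (hLR : ∀ v, L v ≤ R v)
    (hadj : ∀ u v : V, G.Adj u v → L u ≤ R v) : Key G L R 1 := by
  intro A hA hw
  have hsub : ∀ u ∈ A, ∀ v ∈ A, u = v := by
    intro u hu v hv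
    by_contra hne
    obtain ⟨x, hx, y, hy, hxy⟩ := exists_exit _ {u} (hA u hu v hv) rfl (fun h => hne h.symm)
    have h1 := hw (max (L x) (L y))
    rw [Set.ncard_le_one (Set.toFinite _)] at h1
    have h2 := hadj _ _ hxy.1
    have h3 := hadj _ _ hxy.1.symm
    exact hxy.ne (h1 x ⟨hxy.2.1, le_max_left _ _, max_le (hLR x) h3⟩ y
      ⟨hxy.2.2, le_max_right _ _, max_le h2 (hLR y)⟩)
  refine ⟨fun _ => 0, fun _ _ => ⊥, fun v hv => by simp [flane], fun u hu v hv hne =>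
    absurd (hsub u hu v hv) hne, fun u v h => ?_, fun e => ?_⟩
  · have h1 := hsub u h.1 v h.2.1
    have h2 := h.2.2.2.1
    have h3 := hLR u
    rw [← h1] at h2
    omega
  · simp

lemma decode {f a b a' b' : ℕ} (h : a * f + b = a' * f + b') (hb : b < f) (hb' : b' < f) :
    a = a' ∧ b = b' := by
  have h1 : (a * f + b) / f = a := by
    rw [Nat.add_comm, Nat.add_mul_div_right _ _ (by omega), Nat.div_eq_of_lt hb, Nat.zero_add]
  have h2 : (a' * f + b') / f = a' := by
    rw [Nat.add_comm, Nat.add_mul_div_right _ _ (by omega), Nat.div_eq_of_lt hb', Nat.zero_add]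
  have h3 : a = a' := by rw [← h1, ← h2, h]
  subst h3
  exact ⟨rfl, by omega⟩

lemma key_step {V : Type*} [Finite V] (G : SimpleGraph V) (L R : V → ℤ)
    (hLR : ∀ v, L v ≤ R v)
    (hadj : ∀ u v : V, G.Adj u v → L u ≤ R v) (k : ℕ) (ih : Key G L R (k + 1)) :
    Key G L R (k + 2) := by
  classical
  intro A hA hw
  rcases A.eq_empty_or_nonempty with hAe | hne
  · subst hAe
    refine ⟨fun _ => 0, fun _ _ => ⊥, by simp, by simp, fun u v h => absurd h.1 (by simp),
      fun e => by simp⟩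
  have : Nonempty V := ⟨hne.some⟩
  obtain ⟨N, M, P, t, hPA, hPadj, hPinj, htN, htmono, hfar, hcov⟩ :=
    spine G L R hLR hadj A hne hA
  set S : Set V := {v | ∃ n, n ≤ M ∧ P (t n) = v} with hS
  have hSA : S ⊆ A := by
    rintro v ⟨n, hn, rfl⟩
    exact hPA _ (htN n hn)
  set D : Set V := A \ S with hD
  set κ : V → (restr G D).ConnectedComponent := (restr G D).connectedComponentMk with hκ
  have htmono' : ∀ i j, i ≤ j → j ≤ M → t i ≤ t j := by
    intro i j hij hj
    rcases Nat.lt_or_ge i j with h | h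
    · exact (htmono i j h hj).le
    · have : i = j := by omega
      rw [this]
  -- components are connected
  have hBconn : ∀ K, ∀ u ∈ {y | y ∈ D ∧ κ y = K}, ∀ v ∈ {y | y ∈ D ∧ κ y = K},
      (restr G {y | y ∈ D ∧ κ y = K}).Reachable u v := by
    rintro K u ⟨hu, rfl⟩ v ⟨hv, hvu⟩
    exact comp_conn G D (SimpleGraph.ConnectedComponent.eq.1 hvu.symm) hu
  -- width drops
  have hwD : ∀ x : ℤ, {v | v ∈ D ∧ L v ≤ x ∧ x ≤ R v}.ncard ≤ k + 1 := by
    intro x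
    rcases Set.eq_empty_or_nonempty {v | v ∈ D ∧ L v ≤ x ∧ x ≤ R v} with h | ⟨v, hv, hv1, hv2⟩
    · rw [h]; simp
    · obtain ⟨n, hn, hn1, hn2⟩ := hcov v hv.1 x hv1 hv2
      have hlt : {v | v ∈ D ∧ L v ≤ x ∧ x ≤ R v}.ncard <
          {v | v ∈ A ∧ L v ≤ x ∧ x ≤ R v}.ncard := by
        apply Set.ncard_lt_ncard _ (Set.toFinite _)
        have hss : {v | v ∈ D ∧ L v ≤ x ∧ x ≤ R v} ⊆ {v | v ∈ A ∧ L v ≤ x ∧ x ≤ R v} :=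
          fun y hy => ⟨hy.1.1, hy.2⟩
        rw [Set.ssubset_iff_of_subset hss]
        exact ⟨P (t n), ⟨hPA _ (htN n hn), hn1, hn2⟩, fun h => h.1.2 ⟨n, hn, rfl⟩⟩
      have := hw x
      omega
  -- induction hypothesis on components
  have hIH := fun K => ih {y | y ∈ D ∧ κ y = K} (hBconn K) (fun x => by
    have hss : {v | v ∈ {y | y ∈ D ∧ κ y = K} ∧ L v ≤ x ∧ x ≤ R v} ⊆
      {v | v ∈ D ∧ L v ≤ x ∧ x ≤ R v} := fun y hy => ⟨hy.1.1, hy.2⟩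
    exact le_trans (Set.ncard_le_ncard hss (Set.toFinite _)) (hwD x))
  choose c' E' hc'1 hc'2 hE'1 hE'2 using hIH
  -- attachment
  have hatt : ∀ K, ∃ y n, n ≤ M ∧ (K ∈ κ '' D → y ∈ D ∧ κ y = K ∧ G.Adj y (P (t n))) := by
    intro K
    by_cases hK : K ∈ κ '' D
    · obtain ⟨x, hx, hxK⟩ := hK
      have h0S : P (t 0) ∈ S := ⟨0, Nat.zero_le _, rfl⟩
      obtain ⟨y, hy, z, hz, hyz⟩ := exists_exit (restr G A) {y | y ∈ D ∧ κ y = K}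
        (hA x hx.1 (P (t 0)) (hSA h0S)) ⟨hx, hxK⟩ (fun h => h.1.2 h0S)
      have hzS : z ∈ S := by
        by_contra hzS
        have hzD : z ∈ D := ⟨hyz.2.2, hzS⟩
        apply hz
        refine ⟨hzD, ?_⟩
        rw [← hy.2]
        apply SimpleGraph.ConnectedComponent.eq.2
        apply SimpleGraph.Adj.reachable
        exact ⟨hyz.1.symm, hzD, hy.1⟩
      obtain ⟨n, hn, rfl⟩ := hzS
      exact ⟨y, n, hn, fun _ => ⟨hy.1, hy.2, hyz.1⟩⟩
    · exact ⟨P 0, 0, Nat.zero_le _, fun h => absurd h hK⟩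
  choose y ν hνM hatt using hatt
  -- colouring of components
  obtain ⟨d, hd1, hd2, hd3⟩ := comp_coloring G L R hLR hadj D κ (k + 1) hBconn hwD
  -- index on the spine
  have hidx : ∀ v, ∃ n, n ≤ M ∧ (v ∈ S → P (t n) = v) := by
    intro v
    by_cases hv : v ∈ S
    · obtain ⟨n, hn, h⟩ := hv
      exact ⟨n, hn, fun _ => h⟩
    · exact ⟨0, Nat.zero_le _, fun h => absurd h hv⟩
  choose idx hidxM hidx using hidx
  have hDS : ∀ v ∈ A, v ∉ S → v ∈ D := fun v h1 h2 => ⟨h1, h2⟩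
  set f := flane (k + 1) with hf
  obtain ⟨lev, hlevS, hlevD⟩ : ∃ lev : V → ℕ, (∀ v ∈ S, lev v = idx v) ∧
      (∀ v ∈ D, lev v = ν (κ v)) :=
    ⟨fun v => if v ∈ S then idx v else ν (κ v), fun v hv => by simp [hv],
      fun v hv => by simp [hv.2]⟩
  obtain ⟨c, hcS, hcD⟩ : ∃ c : V → ℕ, (∀ v ∈ S, c v = idx v % 2) ∧
      (∀ v ∈ D, c v = 2 + ((d (κ v) * 2 + ν (κ v) % 2) * f + c' (κ v) v)) :=
    ⟨fun v => if v ∈ S then idx v % 2 else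
      2 + ((d (κ v) * 2 + ν (κ v) % 2) * f + c' (κ v) v), fun v hv => by simp [hv],
      fun v hv => by simp [hv.2]⟩
  have hlevM : ∀ v ∈ A, lev v ≤ M := by
    intro v hv
    by_cases hvS : v ∈ S
    · rw [hlevS v hvS]; exact hidxM v
    · rw [hlevD v ⟨hv, hvS⟩]; exact hνM _
  have hcf : ∀ v ∈ D, c' (κ v) v < f := fun v hv => hc'1 (κ v) v ⟨hv, rfl⟩
  -- decoding colours
  have hdec : ∀ u ∈ A, ∀ v ∈ A, c u = c v →
      (u ∈ S ∧ v ∈ S ∧ idx u % 2 = idx v % 2) ∨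
      (u ∈ D ∧ v ∈ D ∧ d (κ u) = d (κ v) ∧ ν (κ u) % 2 = ν (κ v) % 2 ∧
        c' (κ u) u = c' (κ v) v) := by
    intro u hu v hv huv
    by_cases huS : u ∈ S <;> by_cases hvS : v ∈ S
    · left; rw [hcS u huS, hcS v hvS] at huv; exact ⟨huS, hvS, huv⟩
    · rw [hcS u huS, hcD v ⟨hv, hvS⟩] at huv; omega
    · rw [hcD u ⟨hu, huS⟩, hcS v hvS] at huv; omega
    · right
      rw [hcD u ⟨hu, huS⟩, hcD v ⟨hv, hvS⟩] at huv
      obtain ⟨h1, h2⟩ := decode (Nat.add_left_cancel huv) (hcf u ⟨hu, huS⟩) (hcf v ⟨hv, hvS⟩)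
      exact ⟨⟨hu, huS⟩, ⟨hv, hvS⟩, by omega, by omega, h2⟩
  -- colour bound
  have hcF : ∀ v ∈ A, c v < flane (k + 2) := by
    intro v hv
    rw [flane, ← hf]
    by_cases hvS : v ∈ S
    · rw [hcS v hvS]; omega
    · have hvD : v ∈ D := ⟨hv, hvS⟩
      rw [hcD v hvD]
      have h1 := hcf v hvD
      have h2 := hd1 v hvD
      have h3 : (d (κ v) * 2 + ν (κ v) % 2 + 1) * f ≤ 2 * (k + 1) * f :=
        Nat.mul_le_mul_right f (by omega)
      rw [Nat.add_mul, Nat.one_mul] at h3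
      omega
  -- disjointness of colour classes
  have hdisj : ∀ u ∈ A, ∀ v ∈ A, u ≠ v → c u = c v → R u < L v ∨ R v < L u := by
    intro u hu v hv huv hcc
    rcases hdec u hu v hv hcc with ⟨huS, hvS, hp⟩ | ⟨huD, hvD, h1, h2, h3⟩
    · have h1 := hidx u huS
      have h2 := hidx v hvS
      have hne : idx u ≠ idx v := fun h => huv (by rw [← h1, ← h2, h])
      rcases Nat.lt_or_ge (idx u) (idx v) with h | h
      · left
        have := hfar (idx u) (idx v) (by omega) (hidxM v)
        rwa [h1, h2] at this
      · right
        have := hfar (idx v) (idx u) (by omega) (hidxM u)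
        rwa [h1, h2] at this
    · by_cases hK : κ u = κ v
      · rw [hK] at h3
        exact hc'2 (κ v) u ⟨huD, hK⟩ v ⟨hvD, rfl⟩ huv h3
      · exact hd2 u huD v hvD hK h1
  -- monotonicity of the level
  have hlev : ∀ u ∈ A, ∀ v ∈ A, c u = c v → R u < L v → lev u ≤ lev v := by
    intro u hu v hv hcc hlt
    rcases hdec u hu v hv hcc with ⟨huS, hvS, hp⟩ | ⟨huD, hvD, h1, h2, h3⟩
    · rw [hlevS u huS, hlevS v hvS]
      by_contra hcon
      have h4 := hfar (idx v) (idx u) (by omega) (hidxM u)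
      rw [hidx u huS, hidx v hvS] at h4
      have := hLR u
      have := hLR v
      omega
    · rw [hlevD u huD, hlevD v hvD]
      by_cases hK : κ u = κ v
      · rw [hK]
      by_contra hcon
      have h4 := hfar (ν (κ v)) (ν (κ u)) (by omega) (hνM _)
      obtain ⟨h5, h6, h7⟩ := hatt (κ u) ⟨u, huD, rfl⟩
      obtain ⟨h8, h9, h10⟩ := hatt (κ v) ⟨v, hvD, rfl⟩
      have h11 := hd3 u huD v hvD hK h1 hlt _ h5 _ h8 h6 h9
      have h12 := hadj _ _ h7.symm
      have h13 := hadj _ _ h10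
      omega
  have hφ : ∀ u ∈ A, ∀ v ∈ A, c u = c v → R u < L v → t (lev u) ≤ t (lev v) :=
    fun u hu v hv h1 h2 => htmono' _ _ (hlev u hu v hv h1 h2) (hlevM v hv)
  have hφN : ∀ v ∈ A, t (lev v) ≤ N := fun v hv => htN _ (hlevM v hv)
  -- tails
  let T : (restr G D).ConnectedComponent → SimpleGraph V := fun K =>
    restr G ({y | y ∈ D ∧ κ y = K} ∪ {P (t (ν K))})
  obtain ⟨tail, htS, htD⟩ : ∃ tail : V → SimpleGraph V, (∀ v ∈ S, tail v = ⊥) ∧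
      (∀ v ∈ D, tail v = T (κ v)) :=
    ⟨fun v => if v ∈ S then ⊥ else T (κ v), fun v hv => by simp [hv], fun v hv => by simp [hv.2]⟩
  have hTA : ∀ K, T K ≤ restr G A := by
    intro K x z h
    have hsub : ∀ x ∈ ({y | y ∈ D ∧ κ y = K} ∪ {P (t (ν K))} : Set V), x ∈ A := by
      rintro x (hx | hx)
      · exact hx.1.1
      · rw [Set.mem_singleton_iff.1 hx]; exact hPA _ (htN _ (hνM K))
    exact ⟨h.1, hsub x h.2.1, hsub z h.2.2⟩
  have htailA : ∀ v ∈ A, tail v ≤ restr G A := by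
    intro v hv
    by_cases hvS : v ∈ S
    · rw [htS v hvS]; exact bot_le
    · rw [htD v ⟨hv, hvS⟩]; exact hTA _
  have htailR : ∀ v ∈ A, (tail v).Reachable v (P (t (lev v))) := by
    intro v hv
    by_cases hvS : v ∈ S
    · rw [hlevS v hvS, hidx v hvS]
    · have hvD : v ∈ D := ⟨hv, hvS⟩
      rw [htD v hvD, hlevD v hvD]
      obtain ⟨h5, h6, h7⟩ := hatt (κ v) ⟨v, hvD, rfl⟩
      have h8 := hBconn (κ v) v ⟨hvD, rfl⟩ _ ⟨h5, h6⟩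
      refine SimpleGraph.Reachable.trans (h8.mono ?_) (SimpleGraph.Adj.reachable ?_)
      · intro x z hxz
        exact ⟨hxz.1, Or.inl hxz.2.1, Or.inl hxz.2.2⟩
      · exact ⟨h7, Or.inl ⟨h5, h6⟩, Or.inr rfl⟩
  -- the component touched by an edge
  have hTmem : ∀ K e, e ∈ (T K).edgeSet → ∃ x ∈ e, x ∈ D ∧ κ x = K := by
    intro K e
    induction e using Sym2.ind with
    | _ x z =>
      intro he
      have he' : (T K).Adj x z := he
      rcases he'.2.1 with hx | hx
      · exact ⟨x, by simp, hx⟩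
      · rcases he'.2.2 with hz | hz
        · exact ⟨z, by simp, hz⟩
        · exact absurd ((Set.mem_singleton_iff.1 hx).trans (Set.mem_singleton_iff.1 hz).symm)
            he'.ne
  have hTsub : ∀ K e, e ∈ (T K).edgeSet → ∀ x ∈ e, x ∈ D → κ x = K := by
    intro K e
    induction e using Sym2.ind with
    | _ a b =>
      intro he x hx hxD
      have he' : (T K).Adj a b := he
      have hxT : x ∈ ({y | y ∈ D ∧ κ y = K} ∪ {P (t (ν K))} : Set V) := by
        rcases Sym2.mem_iff.1 hx with h | h
        · rw [h]; exact he'.2.1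
        · rw [h]; exact he'.2.2
      rcases hxT with h | h
      · exact h.2
      · exact absurd ⟨ν K, hνM K, (Set.mem_singleton_iff.1 h).symm⟩ hxD.2
  have hTuniq : ∀ K K' e, e ∈ (T K).edgeSet → e ∈ (T K').edgeSet → K = K' := by
    intro K K' e h h'
    obtain ⟨x, hx, hxD, rfl⟩ := hTmem K e h
    exact hTsub K' e h' x hx hxD
  have hBT : ∀ K, restr G {y | y ∈ D ∧ κ y = K} ≤ T K := by
    intro K x z hxz
    exact ⟨hxz.1, Or.inl hxz.2.1, Or.inl hxz.2.2⟩
  have hConsB : ∀ u v, Cons L R A c u v → u ∈ D → v ∈ D → κ u = κ v →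
      Cons L R {y | y ∈ D ∧ κ y = κ u} (c' (κ u)) u v := by
    intro u v h hu hv huv
    refine ⟨⟨hu, rfl⟩, ⟨hv, huv.symm⟩, ?_, h.2.2.2.1, ?_⟩
    · rcases hdec u h.1 v h.2.1 h.2.2.1 with h1 | h1
      · exact absurd h1.1 hu.2
      · rw [h1.2.2.2.2, huv]
    · rintro w ⟨hw, hwu⟩ hcw
      apply h.2.2.2.2 w hw.1
      rw [hcD w hw, hcD u hu, hwu, hcw]
  let E : V → V → SimpleGraph V := fun u v => seg P (t (lev u)) (t (lev v)) ⊔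
    (if u ∈ D ∧ v ∈ D ∧ κ u = κ v then E' (κ u) u v else tail u ⊔ tail v)
  refine ⟨c, E, hcF, hdisj, ?_, ?_⟩
  · intro u v h
    have hseg := seg_reach (restr G A) P N _ _ (hφ u h.1 v h.2.1 h.2.2.1 h.2.2.2.1)
      (hφN v h.2.1) hPadj
    have hsegA := seg_le (restr G A) P N (t (lev u)) (t (lev v)) (hφN v h.2.1) hPadj
    by_cases hc : u ∈ D ∧ v ∈ D ∧ κ u = κ v
    · have hE : E u v = seg P (t (lev u)) (t (lev v)) ⊔ E' (κ u) u v := by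
        simp only [E]; rw [if_pos hc]
      rw [hE]
      obtain ⟨h1, h2⟩ := hE'1 (κ u) u v (hConsB u v h hc.1 hc.2.1 hc.2.2)
      exact ⟨sup_le hsegA ((h1.trans (hBT _)).trans (hTA _)), h2.mono le_sup_right⟩
    · have hE : E u v = seg P (t (lev u)) (t (lev v)) ⊔ (tail u ⊔ tail v) := by
        simp only [E]; rw [if_neg hc]
      rw [hE]
      refine ⟨sup_le hsegA (sup_le (htailA u h.1) (htailA v h.2.1)), ?_⟩
      refine ((htailR u h.1).mono ?_).trans ((hseg.mono le_sup_left).trans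
        ((htailR v h.2.1).symm.mono ?_))
      · exact le_sup_left.trans le_sup_right
      · exact le_sup_right.trans le_sup_right
  · intro e
    have hQ1 := count_spine hdisj (flane (k + 2)) N hcF P hPinj hφN hφ e
    by_cases hK0 : ∃ K, e ∈ (T K).edgeSet
    · obtain ⟨K, heK⟩ := hK0
      have hQ2 := hE'2 K e
      -- outgoing links of the component
      have hQ3 : {q : V × V | Cons L R A c q.1 q.2 ∧ (q.1 ∈ D ∧ κ q.1 = K) ∧
          ¬ (q.2 ∈ D ∧ κ q.2 = K)}.ncard ≤ f := by
        have key : ∀ u v u', Cons L R A c u v → (u ∈ D ∧ κ u = K) → ¬ (v ∈ D ∧ κ v = K) →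
            (u' ∈ D ∧ κ u' = K) → c u' = c u → ¬ R u < L u' := by
          intro u v u' h hu hv hu' hcc hlt
          rcases hdec u h.1 v h.2.1 h.2.2.1 with h1 | h1
          · exact hu.1.2 h1.1
          · have hKne : κ u ≠ κ v := fun hh => hv ⟨h1.2.1, hh.symm.trans hu.2⟩
            exact h.2.2.2.2 u' hu'.1.1 hcc ⟨hlt, hd3 u hu.1 v h1.2.1 hKne h1.2.2.1 h.2.2.2.1
              u' hu'.1 v h1.2.1 (hu'.2.trans hu.2.symm) rfl⟩
        have := Set.ncard_le_ncard_of_injOn (s := {q : V × V | Cons L R A c q.1 q.2 ∧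
            (q.1 ∈ D ∧ κ q.1 = K) ∧ ¬ (q.2 ∈ D ∧ κ q.2 = K)})
          (t := (Finset.range f : Set ℕ)) (fun q => c' K q.1)
          (by
            rintro ⟨u, v⟩ ⟨h, hu, -⟩
            simpa using hc'1 K u hu)
          (by
            rintro ⟨u, v⟩ ⟨h, hu, hv⟩ ⟨u', v'⟩ ⟨h', hu', hv'⟩ hcc
            have hcu : c u = c u' := by
              rw [hcD u hu.1, hcD u' hu'.1, hu.2, hu'.2]
              exact congrArg _ (congrArg _ hcc)
            have huu : u = u' := by
              by_contra hne
              rcases hdisj u h.1 u' h'.1 hne hcu with h1 | h1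
              · exact key u v u' h hu hv hu' hcu.symm h1
              · exact key u' v' u h' hu' hv' hu hcu h1
            subst huu
            exact Prod.ext rfl (h.succ_unique hdisj h'))
          (Set.toFinite _)
        simpa using this
      have hQ4 : {q : V × V | Cons L R A c q.1 q.2 ∧ (q.2 ∈ D ∧ κ q.2 = K) ∧
          ¬ (q.1 ∈ D ∧ κ q.1 = K)}.ncard ≤ f := by
        have key : ∀ u v v', Cons L R A c u v → (v ∈ D ∧ κ v = K) → ¬ (u ∈ D ∧ κ u = K) →
            (v' ∈ D ∧ κ v' = K) → c v' = c v → ¬ R v' < L v := by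
          intro u v v' h hv hu hv' hcc hlt
          rcases hdec u h.1 v h.2.1 h.2.2.1 with h1 | h1
          · exact hv.1.2 h1.2.1
          · have hKne : κ u ≠ κ v := fun hh => hu ⟨h1.1, hh.trans hv.2⟩
            exact h.2.2.2.2 v' hv'.1.1 (hcc.trans h.2.2.1.symm)
              ⟨hd3 u h1.1 v hv.1 hKne h1.2.2.1 h.2.2.2.1
              u h1.1 v' hv'.1 rfl (hv'.2.trans hv.2.symm), hlt⟩
        have := Set.ncard_le_ncard_of_injOn (s := {q : V × V | Cons L R A c q.1 q.2 ∧
            (q.2 ∈ D ∧ κ q.2 = K) ∧ ¬ (q.1 ∈ D ∧ κ q.1 = K)})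
          (t := (Finset.range f : Set ℕ)) (fun q => c' K q.2)
          (by
            rintro ⟨u, v⟩ ⟨h, hv, -⟩
            simpa using hc'1 K v hv)
          (by
            rintro ⟨u, v⟩ ⟨h, hv, hu⟩ ⟨u', v'⟩ ⟨h', hv', hu'⟩ hcc
            have hcu : c v = c v' := by
              rw [hcD v hv.1, hcD v' hv'.1, hv.2, hv'.2]
              exact congrArg _ (congrArg _ hcc)
            have huu : v = v' := by
              by_contra hne
              rcases hdisj v h.2.1 v' h'.2.1 hne hcu with h1 | h1
              · exact key u' v' v h' hv' hu' hv hcu h1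
              · exact key u v v' h hv hu hv' hcu.symm h1
            subst huu
            exact Prod.ext (h.pred_unique hdisj h') rfl)
          (Set.toFinite _)
        simpa using this
      have hsub : {q : V × V | Cons L R A c q.1 q.2 ∧ e ∈ (E q.1 q.2).edgeSet} ⊆
          {q : V × V | Cons L R A c q.1 q.2 ∧
            e ∈ (seg P (t (lev q.1)) (t (lev q.2))).edgeSet} ∪
          ({q : V × V | Cons L R {y | y ∈ D ∧ κ y = K} (c' K) q.1 q.2 ∧
            e ∈ (E' K q.1 q.2).edgeSet} ∪
          ({q : V × V | Cons L R A c q.1 q.2 ∧ (q.1 ∈ D ∧ κ q.1 = K) ∧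
            ¬ (q.2 ∈ D ∧ κ q.2 = K)} ∪
          {q : V × V | Cons L R A c q.1 q.2 ∧ (q.2 ∈ D ∧ κ q.2 = K) ∧
            ¬ (q.1 ∈ D ∧ κ q.1 = K)})) := by
        rintro ⟨u, v⟩ ⟨h, he⟩
        simp only [E, SimpleGraph.edgeSet_sup] at h he
        rcases he with he | he
        · exact Or.inl ⟨h, he⟩
        right
        by_cases hc : u ∈ D ∧ v ∈ D ∧ κ u = κ v
        · left
          rw [if_pos hc] at he
          have h1 := hConsB u v h hc.1 hc.2.1 hc.2.2
          have h2 := (hE'1 (κ u) u v h1).1.trans (hBT _)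
          have h3 : κ u = K := hTuniq _ _ e (SimpleGraph.edgeSet_mono h2 he) heK
          rw [h3] at h1 he
          exact ⟨h1, he⟩
        · right
          rw [if_neg hc, SimpleGraph.edgeSet_sup] at he
          have htl : ∀ w ∈ A, e ∈ (tail w).edgeSet → w ∈ D ∧ κ w = K := by
            intro w hw hew
            by_cases hwS : w ∈ S
            · rw [htS w hwS] at hew
              simp at hew
            · have hwD : w ∈ D := ⟨hw, hwS⟩
              rw [htD w hwD] at hew
              exact ⟨hwD, hTuniq _ _ e hew heK⟩
          rcases he with he | he
          · left
            have h1 := htl u h.1 he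
            exact ⟨h, h1, fun h2 => hc ⟨h1.1, h2.1, h1.2.trans h2.2.symm⟩⟩
          · right
            have h1 := htl v h.2.1 he
            exact ⟨h, h1, fun h2 => hc ⟨h2.1, h1.1, h2.2.trans h1.2.symm⟩⟩
      have hb := Set.ncard_le_ncard hsub (Set.toFinite _)
      have hb1 := Set.ncard_union_le {q : V × V | Cons L R A c q.1 q.2 ∧
            e ∈ (seg P (t (lev q.1)) (t (lev q.2))).edgeSet}
          ({q : V × V | Cons L R {y | y ∈ D ∧ κ y = K} (c' K) q.1 q.2 ∧
            e ∈ (E' K q.1 q.2).edgeSet} ∪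
          ({q : V × V | Cons L R A c q.1 q.2 ∧ (q.1 ∈ D ∧ κ q.1 = K) ∧
            ¬ (q.2 ∈ D ∧ κ q.2 = K)} ∪
          {q : V × V | Cons L R A c q.1 q.2 ∧ (q.2 ∈ D ∧ κ q.2 = K) ∧
            ¬ (q.1 ∈ D ∧ κ q.1 = K)}))
      have hb2 := Set.ncard_union_le
          {q : V × V | Cons L R {y | y ∈ D ∧ κ y = K} (c' K) q.1 q.2 ∧
            e ∈ (E' K q.1 q.2).edgeSet}
          ({q : V × V | Cons L R A c q.1 q.2 ∧ (q.1 ∈ D ∧ κ q.1 = K) ∧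
            ¬ (q.2 ∈ D ∧ κ q.2 = K)} ∪
          {q : V × V | Cons L R A c q.1 q.2 ∧ (q.2 ∈ D ∧ κ q.2 = K) ∧
            ¬ (q.1 ∈ D ∧ κ q.1 = K)})
      have hb3 := Set.ncard_union_le
          {q : V × V | Cons L R A c q.1 q.2 ∧ (q.1 ∈ D ∧ κ q.1 = K) ∧
            ¬ (q.2 ∈ D ∧ κ q.2 = K)}
          {q : V × V | Cons L R A c q.1 q.2 ∧ (q.2 ∈ D ∧ κ q.2 = K) ∧
            ¬ (q.1 ∈ D ∧ κ q.1 = K)}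
      have hfin : flane (k + 2) + (glane (k + 1) + (f + f)) = glane (k + 2) := by
        rw [flane, glane, ← hf]; ring
      omega
    · push Not at hK0
      have hsub : {q : V × V | Cons L R A c q.1 q.2 ∧ e ∈ (E q.1 q.2).edgeSet} ⊆
          {q : V × V | Cons L R A c q.1 q.2 ∧
            e ∈ (seg P (t (lev q.1)) (t (lev q.2))).edgeSet} := by
        rintro ⟨u, v⟩ ⟨h, he⟩
        simp only [E, SimpleGraph.edgeSet_sup] at h he
        rcases he with he | he
        · exact ⟨h, he⟩
        exfalso
        by_cases hc : u ∈ D ∧ v ∈ D ∧ κ u = κ v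
        · rw [if_pos hc] at he
          have h1 := hConsB u v h hc.1 hc.2.1 hc.2.2
          have h2 := (hE'1 (κ u) u v h1).1.trans (hBT _)
          exact hK0 _ (SimpleGraph.edgeSet_mono h2 he)
        · rw [if_neg hc, SimpleGraph.edgeSet_sup] at he
          have htl : ∀ w ∈ A, e ∉ (tail w).edgeSet := by
            intro w hw hew
            by_cases hwS : w ∈ S
            · rw [htS w hwS] at hew
              simp at hew
            · rw [htD w ⟨hw, hwS⟩] at hew
              exact hK0 _ hew
          rcases he with he | he
          · exact htl u h.1 he
          · exact htl v h.2.1 he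
      have hb := Set.ncard_le_ncard hsub (Set.toFinite _)
      have hfin : flane (k + 2) + (glane (k + 1) + (f + f)) = glane (k + 2) := by
        rw [flane, glane, ← hf]; ring
      omega

lemma key_all {V : Type*} [Finite V] (G : SimpleGraph V) (L R : V → ℤ)
    (hLR : ∀ v, L v ≤ R v)
    (hadj : ∀ u v : V, G.Adj u v → L u ≤ R v) (k : ℕ) : Key G L R k := by
  induction k with
  | zero => exact key_zero G L R hLR
  | succ k ih =>
    cases k with
    | zero => exact key_one G L R hLR hadj
    | succ k => exact key_step G L R hLR hadj k ih

/-- For every connected graph `G` with an interval representation of width `k`,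
there is a partition of the vertices into `w ≤ f(k)` lanes — lane `i` being the
sequence `P i 0, …, P i (m i)` whose intervals are pairwise disjoint and strictly
increasing — together with an embedding of the weak-completion edges (joining
consecutive vertices of each lane) as paths in `G` such that every edge of `G` is
used by at most `g(k)` of these paths. -/
theorem stmt_18 {V : Type*} [Fintype V] [DecidableEq V] (G : SimpleGraph V)
    (hconn : G.Connected) (k : ℕ) (L R : V → ℤ) (hLR : ∀ v, L v ≤ R v)
    (hadj : ∀ u v : V, G.Adj u v →
      (Set.Icc (L u) (R u) ∩ Set.Icc (L v) (R v)).Nonempty)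
    (hwidth : ∀ x : ℤ, (Finset.univ.filter (fun v => L v ≤ x ∧ x ≤ R v)).card ≤ k) :
    ∃ w : ℕ, w ≤ flane k ∧
    ∃ (m : Fin w → ℕ) (P : Fin w → ℕ → V),
      (∀ v : V, ∃ (i : Fin w) (j : ℕ), j ≤ m i ∧ P i j = v) ∧
      (∀ (i i' : Fin w) (j j' : ℕ), j ≤ m i → j' ≤ m i' →
        P i j = P i' j' → i = i' ∧ j = j') ∧
      (∀ (i : Fin w) (j : ℕ), j < m i → R (P i j) < L (P i (j + 1))) ∧
      ∃ W : ∀ (i : Fin w) (j : ℕ), j < m i → G.Walk (P i j) (P i (j + 1)),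
        (∀ (i : Fin w) (j : ℕ) (h : j < m i), (W i j h).IsPath) ∧
        ∀ e ∈ G.edgeSet,
          {q : Fin w × ℕ | ∃ h : q.2 < m q.1, e ∈ (W q.1 q.2 h).edges}.ncard
            ≤ glane k := by
  classical
  have hadj' : ∀ u v : V, G.Adj u v → L u ≤ R v := by
    intro u v h
    obtain ⟨x, hx1, hx2⟩ := hadj u v h
    exact hx1.1.trans hx2.2
  have hres : G ≤ restr G Set.univ := fun x y h => ⟨h, trivial, trivial⟩
  obtain ⟨c, E, hc, hdisj, hE1, hE2⟩ := key_all G L R hLR hadj' k Set.univ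
    (fun u _ v _ => (hconn.preconnected u v).mono hres)
    (fun x => by
      have h1 := hwidth x
      rw [← Set.ncard_coe_finset] at h1
      refine le_trans (le_of_eq (congrArg Set.ncard ?_)) h1
      ext v
      simp)
  set I : Finset ℕ := Finset.univ.image c with hI
  have hIcard : I.card ≤ flane k := by
    have : I ⊆ Finset.range (flane k) := by
      intro i hi
      obtain ⟨v, -, rfl⟩ := Finset.mem_image.1 hi
      exact Finset.mem_range.2 (hc v trivial)
    simpa using Finset.card_le_card this
  let en : Fin I.card ≃ I := I.equivFin.symm
  have hlane : ∀ i : Fin I.card, ∃ (m : ℕ) (P : ℕ → V),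
      (∀ v, v ∈ Finset.univ.filter (fun v => c v = (en i : ℕ)) ↔ ∃ j ≤ m, P j = v) ∧
      ∀ j j', j < j' → j' ≤ m → R (P j) < L (P j') := by
    intro i
    apply sort_lane L R hLR
    · obtain ⟨v, -, hv⟩ := Finset.mem_image.1 (en i).2
      exact ⟨v, by simpa using hv⟩
    · intro u hu v hv huv
      rw [Finset.mem_filter] at hu hv
      exact hdisj u trivial v trivial huv (hu.2.trans hv.2.symm)
  choose m P hP1 hP2 using hlane
  have hPc : ∀ i j, j ≤ m i → c (P i j) = (en i : ℕ) := fun i j hj =>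
    (Finset.mem_filter.1 ((hP1 i (P i j)).2 ⟨j, hj, rfl⟩)).2
  have hinj : ∀ (i i' : Fin I.card) (j j' : ℕ), j ≤ m i → j' ≤ m i' →
        P i j = P i' j' → i = i' ∧ j = j' := by
    intro i i' j j' hj hj' h
    have hii : i = i' := by
      apply en.injective
      apply Subtype.ext
      rw [← hPc i j hj, ← hPc i' j' hj', h]
    subst hii
    refine ⟨rfl, ?_⟩
    have h5 := hLR (P i j)
    rcases lt_trichotomy j j' with h1 | h1 | h1
    · have h2 := hP2 i j j' h1 hj'
      rw [← h] at h2
      omega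
    · exact h1
    · have h2 := hP2 i j' j h1 hj
      rw [← h] at h2
      omega
  have hcons : ∀ i j, j < m i → Cons L R Set.univ c (P i j) (P i (j + 1)) := by
    intro i j hj
    refine ⟨trivial, trivial, ?_, hP2 i j (j + 1) (by omega) hj, ?_⟩
    · rw [hPc i j hj.le, hPc i (j + 1) hj]
    · rintro w - hw ⟨h1, h2⟩
      rw [hPc i j hj.le] at hw
      obtain ⟨l, hl, rfl⟩ := (hP1 i w).1 (by simpa using hw)
      have h3 := hLR (P i l)
      have h4 := hLR (P i j)
      have h5 := hLR (P i (j + 1))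
      rcases Nat.lt_or_ge j l with h | h
      · rcases Nat.eq_or_lt_of_le (show j + 1 ≤ l from h) with h6 | h6
        · rw [← h6] at h2 h3; omega
        · have := hP2 i (j + 1) l h6 hl
          omega
      · rcases Nat.eq_or_lt_of_le h with h6 | h6
        · rw [h6] at h1; omega
        · have := hP2 i l j h6 hj.le
          omega
  have hresG : restr G Set.univ ≤ G := fun x y h => h.1
  have hwalk : ∀ i j, ∀ h : j < m i, ∃ p : G.Walk (P i j) (P i (j + 1)), p.IsPath ∧
      ∀ e ∈ p.edges, e ∈ (E (P i j) (P i (j + 1))).edgeSet := by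
    intro i j h
    obtain ⟨h1, h2⟩ := hE1 _ _ (hcons i j h)
    obtain ⟨p, hp⟩ := h2.exists_isPath
    refine ⟨p.mapLe (h1.trans hresG), (SimpleGraph.Walk.isPath_mapLe _).2 hp, ?_⟩
    intro e he
    rw [SimpleGraph.Walk.edges_mapLe_eq_edges] at he
    exact p.edges_subset_edgeSet he
  choose W hW1 hW2 using hwalk
  refine ⟨I.card, hIcard, m, P, ?_, hinj, fun i j hj => hP2 i j (j + 1) (by omega) hj, W, hW1, ?_⟩
  · intro v
    have hv : c v ∈ I := Finset.mem_image_of_mem c (Finset.mem_univ v)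
    obtain ⟨j, hj, h⟩ := (hP1 (en.symm ⟨c v, hv⟩) v).1 (by simp)
    exact ⟨_, j, hj, h⟩
  · intro e _
    refine le_trans ?_ (hE2 e)
    refine Set.ncard_le_ncard_of_injOn (fun q => (P q.1 q.2, P q.1 (q.2 + 1))) ?_ ?_
      (Set.toFinite _)
    · rintro ⟨i, j⟩ ⟨h, he⟩
      exact ⟨hcons i j h, hW2 i j h e he⟩
    · rintro ⟨i, j⟩ ⟨h, he⟩ ⟨i', j'⟩ ⟨h', he'⟩ hq
      obtain ⟨h1, h2⟩ := hinj i i' j j' h.le h'.le (Prod.ext_iff.1 hq).1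
      exact Prod.ext h1 h2
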